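/- Consider a Par-Seq instance of n jobs with n ≥ 16 executed by Equi on one processor, encoded by reals a_j and c_j as in the context. Then the makespan T = max_j c_j satisfies T ≤ ( (Real.log n)/(Real.log (Real.log n))^2 + 1 + (Real.log n)/(Real.log (Real.log n) − 2·Real.log (Real.log (Real.log n))) ) · max( ∑_{j=1}^n P_j , max_{j=1..n} Q_j ). (For n ≥ 16 one has (log log n)^2 < log n and log log n − 2 log log log n > 0, so the bound is well defined; it is obtained by choosing α = (log log n)^2 / log n.) -/

import Mathlib

open MeasureTheory

/-- The integral of `L t - L (t + M)` over `[0, S]` telescopes, so it is at most `M * K` as soon as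
`0 ≤ L ≤ K`. -/
theorem integral_sub_shift_le {L : ℝ → ℝ} (hL : Antitone L) {K M S : ℝ} (hM : 0 ≤ M)
    (hL0 : ∀ t, 0 ≤ L t) (hLK : ∀ t, L t ≤ K) :
    ∫ t in (0 : ℝ)..S, (L t - L (t + M)) ≤ M * K := by
  have hint : ∀ x y, IntervalIntegrable L volume x y := fun x y => hL.intervalIntegrable
  have hshift : IntervalIntegrable (fun t => L (t + M)) volume 0 S :=
    Antitone.intervalIntegrable fun x y hxy => hL (by linarith)
  rw [intervalIntegral.integral_sub (hint _ _) hshift,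
    intervalIntegral.integral_comp_add_right (fun t => L t), zero_add]
  have h₁ := intervalIntegral.integral_add_adjacent_intervals (hint 0 M) (hint M (S + M))
  have h₂ := intervalIntegral.integral_add_adjacent_intervals (hint 0 S) (hint S (S + M))
  have h₃ : 0 ≤ ∫ t in S..(S + M), L t :=
    intervalIntegral.integral_nonneg (by linarith) fun t _ => hL0 t
  have h₄ : ∫ t in (0 : ℝ)..M, L t ≤ ∫ _ in (0 : ℝ)..M, K :=
    intervalIntegral.integral_mono_on hM (hint _ _) intervalIntegrable_const fun t _ => hLK t
  rw [intervalIntegral.integral_const, smul_eq_mul, sub_zero] at h₄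
  linarith

/-- Cutting a nonnegative function off at `b` bounds its integral over `[0, S]` by the one over
`[0, b]`. -/
theorem integral_ite_lt_le {f : ℝ → ℝ} (hf : ∀ x y, IntervalIntegrable f volume x y)
    (hf0 : ∀ t, 0 ≤ f t) {b S : ℝ} (hb : 0 ≤ b) (hS : 0 ≤ S) :
    ∫ t in (0 : ℝ)..S, (if t < b then f t else 0) ≤ ∫ t in (0 : ℝ)..b, f t := by
  have hite : (fun t => if t < b then f t else 0) = (Set.Iio b).indicator f := by
    ext t
    simp [Set.indicator_apply]
  rw [hite, intervalIntegral.integral_of_le hS, intervalIntegral.integral_of_le hb,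
    setIntegral_indicator measurableSet_Iio]
  refine setIntegral_mono_set ((intervalIntegrable_iff_integrableOn_Ioc_of_le hb).1 (hf 0 b))
    (Filter.Eventually.of_forall hf0) (Filter.Eventually.of_forall ?_)
  rintro t ⟨⟨h0, -⟩, h1⟩
  exact ⟨h0, le_of_lt h1⟩

/-- Makespan bound for `Equi` with a free threshold `α` on the fraction of uncompleted jobs that
are in their parallel phase. -/
theorem equi_makespan_bound {n : ℕ} {P Q a c : Fin n → ℝ} (ha : ∀ j, 0 ≤ a j)
    (hc : ∀ j, c j = a j + Q j) {N : ℝ → ℝ}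
    (hN : ∀ t, N t = ((Finset.univ.filter fun j => t < c j).card : ℝ))
    (hwork : ∀ j, (∫ t in (0:ℝ)..(a j), (N t)⁻¹) = P j)
    {α M : ℝ} (hα0 : 0 < α) (hα1 : α < 1) (hM : 0 ≤ M) (hPM : ∑ j, P j ≤ M)
    (hQM : ∀ j, Q j ≤ M) (i : Fin n) :
    c i ≤ (1 / α + 1 + Real.log n / Real.log (1 / α)) * M := by
  have hlogα : 0 < Real.log (1 / α) := Real.log_pos (by rw [lt_div_iff₀ hα0]; linarith)
  have hlogn : 0 ≤ Real.log n := Real.log_natCast_nonneg n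
  rcases le_total (c i) M with hle | hge
  · have h : 0 ≤ (1 / α + Real.log n / Real.log (1 / α)) * M := by positivity
    linarith
  have hS : 0 ≤ c i - M := by linarith
  have hNanti : Antitone N := by
    intro x y hxy
    rw [hN, hN]
    exact_mod_cast Finset.card_le_card
      (Finset.monotone_filter_right _ fun j _ hj => lt_of_le_of_lt hxy hj)
  have hN0 : ∀ t, 0 ≤ N t := fun t => by rw [hN]; positivity
  have hNn : ∀ t, N t ≤ n := fun t => by
    rw [hN]
    exact_mod_cast (Finset.card_le_univ _).trans_eq (Fintype.card_fin n)
  have hN1 : ∀ t, t < c i → 1 ≤ N t := fun t ht => by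
    rw [hN]
    exact_mod_cast Finset.card_pos.2 ⟨i, by simpa using ht⟩
  have hinv : ∀ x y, IntervalIntegrable (fun t => (N t)⁻¹) volume x y := by
    intro x y
    refine (intervalIntegrable_const (c := (1 : ℝ))).mono_fun
      hNanti.measurable.inv.aestronglyMeasurable (Filter.Eventually.of_forall fun t => ?_)
    simp only [hN, norm_inv, norm_one, RCLike.norm_natCast]
    exact Nat.cast_inv_le_one _
  -- `log 0 = 0`, so the logarithm is monotone on natural numbers
  have hLanti : Antitone fun t => Real.log (N t) := by
    intro x y hxy
    have h := hNanti hxy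
    change Real.log (N y) ≤ Real.log (N x)
    rcases (hN0 y).eq_or_lt with h0 | h0
    · rw [← h0, Real.log_zero, hN]
      exact Real.log_natCast_nonneg _
    · exact Real.log_le_log h0 h
  have hL0 : ∀ t, 0 ≤ Real.log (N t) := fun t => by
    rw [hN]
    exact Real.log_natCast_nonneg _
  have hLn : ∀ t, Real.log (N t) ≤ Real.log n := by
    intro t
    rcases (hN0 t).eq_or_lt with h0 | h0
    · rwa [← h0, Real.log_zero]
    · exact Real.log_le_log h0 (hNn t)
  have hLint : IntervalIntegrable (fun t => Real.log (N t) - Real.log (N (t + M))) volume 0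
      (c i - M) :=
    hLanti.intervalIntegrable.sub
      (Antitone.intervalIntegrable fun x y hxy => hLanti (by linarith))
  have hgint : ∀ j, IntervalIntegrable (fun t => if t < a j then (N t)⁻¹ else 0) volume 0
      (c i - M) := by
    intro j
    refine (hinv 0 (c i - M)).mono_fun
      (Measurable.ite measurableSet_Iio hNanti.measurable.inv
        measurable_const).aestronglyMeasurable (Filter.Eventually.of_forall fun t => ?_)
    dsimp only
    split_ifs
    · exact le_rfl
    · simp
  have hsum : ∀ t, ∑ j, (if t < a j then (N t)⁻¹ else 0) =
      ((Finset.univ.filter fun j => t < a j).card : ℝ) * (N t)⁻¹ := by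
    intro t
    rw [← Finset.sum_filter, Finset.sum_const, nsmul_eq_mul]
  have hsumint : IntervalIntegrable (fun t => ∑ j, (if t < a j then (N t)⁻¹ else 0)) volume 0
      (c i - M) := by
    simpa [Finset.sum_fn] using IntervalIntegrable.sum Finset.univ fun j _ => hgint j
  have hpar : ∫ t in (0 : ℝ)..(c i - M), ∑ j, (if t < a j then (N t)⁻¹ else 0) ≤ M := by
    rw [intervalIntegral.integral_finsetSum fun j _ => hgint j]
    refine le_trans (Finset.sum_le_sum fun j _ => ?_) hPM
    rw [← hwork j]
    exact integral_ite_lt_le hinv (fun t => inv_nonneg.2 (hN0 t)) (ha j) hS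
  have hlog := integral_sub_shift_le (S := c i - M) hLanti hM hL0 hLn
  have hpoint : ∀ t ∈ Set.Ioo (0 : ℝ) (c i - M),
      1 ≤ (1 / α) * ∑ j, (if t < a j then (N t)⁻¹ else 0) +
        (1 / Real.log (1 / α)) * (Real.log (N t) - Real.log (N (t + M))) := by
    intro t ht
    have ht1 : 1 ≤ N t := hN1 t (by linarith [ht.2])
    have ht2 : 1 ≤ N (t + M) := hN1 (t + M) (by linarith [ht.2])
    have hstep : N (t + M) ≤ ((Finset.univ.filter fun j => t < a j).card : ℝ) := by
      rw [hN]
      refine Nat.cast_le.2 (Finset.card_le_card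
        (Finset.monotone_filter_right _ fun j _ hj => ?_))
      have h₁ := hQM j
      have h₂ := hc j
      linarith
    rw [hsum]
    set A : ℝ := ((Finset.univ.filter fun j => t < a j).card : ℝ)
    rcases le_total (α * N t) A with h | h
    · have h₁ : 1 ≤ (1 / α) * (A * (N t)⁻¹) := by
        rw [show (1 / α) * (A * (N t)⁻¹) = A / (α * N t) by field_simp]
        exact (one_le_div (by positivity)).2 h
      have h₂ : 0 ≤ (1 / Real.log (1 / α)) * (Real.log (N t) - Real.log (N (t + M))) :=
        mul_nonneg (by positivity) (sub_nonneg.2 (hLanti (by linarith)))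
      linarith
    · have h₁ : 0 ≤ (1 / α) * (A * (N t)⁻¹) := by positivity
      have h₂ : Real.log (N (t + M)) ≤ Real.log α + Real.log (N t) := by
        rw [← Real.log_mul hα0.ne' (by positivity)]
        exact Real.log_le_log (by linarith) (hstep.trans h)
      have h₃ : 1 ≤ (1 / Real.log (1 / α)) * (Real.log (N t) - Real.log (N (t + M))) := by
        rw [one_div_mul_eq_div, one_le_div hlogα, one_div, Real.log_inv]
        linarith
      linarith
  have hint := intervalIntegral.integral_mono_on_of_le_Ioo hS intervalIntegrable_const
    ((hsumint.const_mul (1 / α)).add (hLint.const_mul (1 / Real.log (1 / α)))) hpoint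
  rw [intervalIntegral.integral_const, intervalIntegral.integral_add (hsumint.const_mul _)
    (hLint.const_mul _), intervalIntegral.integral_const_mul,
    intervalIntegral.integral_const_mul, smul_eq_mul, mul_one, sub_zero] at hint
  have h₁ := mul_le_mul_of_nonneg_left hpar (one_div_pos.2 hα0).le
  have h₂ := mul_le_mul_of_nonneg_left hlog (one_div_pos.2 hlogα).le
  calc c i ≤ 1 / α * M + 1 / Real.log (1 / α) * (M * Real.log n) + M := by linarith
    _ = _ := by ring


/-- Makespan bound for `Equi` on a Par-Seq instance of `n ≥ 16` jobs on one processor,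
with the explicit choice `α = (log log n)^2 / log n`:
`T ≤ (log n/(log log n)^2 + 1 + log n/(log log n − 2 log log log n)) · max(∑ P, max Q)`. -/
theorem equi_makespan_bound_explicit
    (n : ℕ) (hn : 16 ≤ n)
    (P Q a c : Fin n → ℝ)
    (hP : ∀ j, 0 ≤ P j) (hQ : ∀ j, 0 ≤ Q j) (ha : ∀ j, 0 ≤ a j)
    (hc : ∀ j, c j = a j + Q j)
    (N : ℝ → ℝ)
    (hN : ∀ t, N t = ((Finset.univ.filter fun j => t < c j).card : ℝ))
    (hwork : ∀ j, (∫ t in (0:ℝ)..(a j), (N t)⁻¹) = P j)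
    (T : ℝ)
    (hT : T = Finset.univ.sup' ⟨⟨0, by omega⟩, Finset.mem_univ _⟩ c) :
    T ≤ (Real.log n / (Real.log (Real.log n)) ^ 2 + 1 +
          Real.log n / (Real.log (Real.log n) - 2 * Real.log (Real.log (Real.log n)))) *
        max (∑ j, P j) (Finset.univ.sup' ⟨⟨0, by omega⟩, Finset.mem_univ _⟩ Q) := by
  have hx1 : 1 < Real.log n := by
    rw [Real.lt_log_iff_exp_lt (by positivity)]
    have h : (16 : ℝ) ≤ n := by exact_mod_cast hn
    linarith [Real.exp_one_lt_d9]
  set x := Real.log n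
  have hy0 : 0 < Real.log x := Real.log_pos hx1
  set y := Real.log x
  have hx0 : 0 < x := by linarith
  have hyx : y ^ 2 < x := by
    have h : y < Real.exp (y / 2) := by
      nlinarith [Real.exp_one_mul_le_exp (x := y / 2), Real.exp_one_gt_d9]
    calc y ^ 2 < Real.exp (y / 2) ^ 2 := pow_lt_pow_left₀ h hy0.le two_ne_zero
      _ = Real.exp y := by rw [← Real.exp_nat_mul]; congr 1; push_cast; ring
      _ = x := Real.exp_log hx0
  have hα : Real.log (1 / (y ^ 2 / x)) = y - 2 * Real.log y := by
    rw [one_div_div, Real.log_div hx0.ne' (by positivity), Real.log_pow]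
    push_cast
    rfl
  refine hT.trans_le (Finset.sup'_le _ _ fun i _ => ?_)
  have h := equi_makespan_bound ha hc hN hwork (α := y ^ 2 / x) (by positivity)
    ((div_lt_one hx0).2 hyx) ((Finset.sum_nonneg fun j _ => hP j).trans (le_max_left _ _))
    (le_max_left (∑ j, P j) (Finset.univ.sup' ⟨⟨0, by omega⟩, Finset.mem_univ _⟩ Q))
    (fun j => (Finset.le_sup' Q (Finset.mem_univ j)).trans (le_max_right _ _)) i
  rwa [hα, one_div_div] at h
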